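/- Let A(x) denote the 2×2 rotation matrix ((cos x, −sin x),(sin x, cos x)). Let R₄(x₁,x₂,x₃) be the 14×14 block-diagonal matrix diag(A(x₁), A(x₂), A(x₃), A(x₁+x₂), A(x₁+x₃), A(x₂+x₃), A(x₁+x₂+x₃)), let h(z) = −20 + 9 sin z + 13 cos z − 7 sin(2z) + 3 cos(2z), and let v₄ : ℝ → ℝ¹⁴ be v₄(z) = (2, 1+sin z, cos z, 1/2+sin z, cos z, sin z, cos z, 2−cos z, −2 sin z − 5 cos z, sin z, cos z, sin z, cos z, h(z)). Define F₄ : ℝ⁴ → ℝ¹⁴ by F₄(x₁,x₂,x₃,z) = R₄(x₁,x₂,x₃)·v₄(z). Then F₄ is free: at every point of ℝ⁴ the fourteen vectors of first and second partial derivatives of F₄ (the four first derivatives ∂_{x₁}F₄, ∂_{x₂}F₄, ∂_{x₃}F₄, ∂_zF₄ and the ten second derivatives ∂_{x_ix_j}F₄ for 1≤i≤j≤3, ∂_{x_iz}F₄ for i=1,2,3, and ∂_{zz}F₄) are linearly independent in ℝ¹⁴. Since F₄ is 2π-periodic in each variable, it induces a smooth free map of the 4-torus T⁴ into ℝ¹⁴,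 which is the critical dimension q₄ = 4·(4+3)/2 = 14. -/

import Mathlib

open Real Matrix

/-- The 14×14 block-diagonal rotation matrix
`R₄(x₁,x₂,x₃) = diag(A(x₁), A(x₂), A(x₃), A(x₁+x₂), A(x₁+x₃), A(x₂+x₃), A(x₁+x₂+x₃))`,
where `A(t)` is the 2×2 rotation matrix `((cos t, −sin t),(sin t, cos t))`. -/
noncomputable def R₄ (x₁ x₂ x₃ : ℝ) : Matrix (Fin 14) (Fin 14) ℝ :=
  !![cos (x₁), -sin (x₁), 0, 0, 0, 0, 0, 0, 0, 0, 0, 0, 0, 0;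
    sin (x₁), cos (x₁), 0, 0, 0, 0, 0, 0, 0, 0, 0, 0, 0, 0;
    0, 0, cos (x₂), -sin (x₂), 0, 0, 0, 0, 0, 0, 0, 0, 0, 0;
    0, 0, sin (x₂), cos (x₂), 0, 0, 0, 0, 0, 0, 0, 0, 0, 0;
    0, 0, 0, 0, cos (x₃), -sin (x₃), 0, 0, 0, 0, 0, 0, 0, 0;
    0, 0, 0, 0, sin (x₃), cos (x₃), 0, 0, 0, 0, 0, 0, 0, 0;
    0, 0, 0, 0, 0, 0, cos (x₁ + x₂), -sin (x₁ + x₂), 0, 0, 0, 0, 0, 0;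
    0, 0, 0, 0, 0, 0, sin (x₁ + x₂), cos (x₁ + x₂), 0, 0, 0, 0, 0, 0;
    0, 0, 0, 0, 0, 0, 0, 0, cos (x₁ + x₃), -sin (x₁ + x₃), 0, 0, 0, 0;
    0, 0, 0, 0, 0, 0, 0, 0, sin (x₁ + x₃), cos (x₁ + x₃), 0, 0, 0, 0;
    0, 0, 0, 0, 0, 0, 0, 0, 0, 0, cos (x₂ + x₃), -sin (x₂ + x₃), 0, 0;
    0, 0, 0, 0, 0, 0, 0, 0, 0, 0, sin (x₂ + x₃), cos (x₂ + x₃), 0, 0;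
    0, 0, 0, 0, 0, 0, 0, 0, 0, 0, 0, 0, cos (x₁ + x₂ + x₃), -sin (x₁ + x₂ + x₃);
    0, 0, 0, 0, 0, 0, 0, 0, 0, 0, 0, 0, sin (x₁ + x₂ + x₃), cos (x₁ + x₂ + x₃)]

/-- `h(z) = −20 + 9 sin z + 13 cos z − 7 sin 2z + 3 cos 2z`. -/
noncomputable def h (z : ℝ) : ℝ :=
  -20 + 9 * sin z + 13 * cos z - 7 * sin (2 * z) + 3 * cos (2 * z)

/-- The loop `v₄ : ℝ → ℝ¹⁴`. -/
noncomputable def v₄ (z : ℝ) : Fin 14 → ℝ :=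
  ![2, 1 + sin z, cos z, 1 / 2 + sin z, cos z, sin z, cos z, 2 - cos z,
    -2 * sin z - 5 * cos z, sin z, cos z, sin z, cos z, h z]

/-- The map `F₄(x₁,x₂,x₃,z) = R₄(x₁,x₂,x₃)·v₄(z) : ℝ⁴ → ℝ¹⁴`. -/
noncomputable def F₄ (x₁ x₂ x₃ z : ℝ) : Fin 14 → ℝ := R₄ x₁ x₂ x₃ *ᵥ v₄ z

lemma R₄_mulVec (x₁ x₂ x₃ : ℝ) (v : Fin 14 → ℝ) :
    R₄ x₁ x₂ x₃ *ᵥ v =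
      ![cos x₁ * v 0 - sin x₁ * v 1, sin x₁ * v 0 + cos x₁ * v 1,
        cos x₂ * v 2 - sin x₂ * v 3, sin x₂ * v 2 + cos x₂ * v 3,
        cos x₃ * v 4 - sin x₃ * v 5, sin x₃ * v 4 + cos x₃ * v 5,
        cos (x₁ + x₂) * v 6 - sin (x₁ + x₂) * v 7, sin (x₁ + x₂) * v 6 + cos (x₁ + x₂) * v 7,
        cos (x₁ + x₃) * v 8 - sin (x₁ + x₃) * v 9, sin (x₁ + x₃) * v 8 + cos (x₁ + x₃) * v 9,
        cos (x₂ + x₃) * v 10 - sin (x₂ + x₃) * v 11, sin (x₂ + x₃) * v 10 + cos (x₂ + x₃) * v 11,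
        cos (x₁ + x₂ + x₃) * v 12 - sin (x₁ + x₂ + x₃) * v 13,
        sin (x₁ + x₂ + x₃) * v 12 + cos (x₁ + x₂ + x₃) * v 13] := by
  ext i
  fin_cases i <;> simp [R₄, mulVec, dotProduct, Fin.sum_univ_succ, sub_eq_add_neg]

/-- The infinitesimal generator of `R₄` in the direction `(a, b, c)`. -/
def rotGen (a b c : ℝ) (v : Fin 14 → ℝ) : Fin 14 → ℝ :=
  ![-(a * v 1), a * v 0, -(b * v 3), b * v 2, -(c * v 5), c * v 4,
    -((a + b) * v 7), (a + b) * v 6, -((a + c) * v 9), (a + c) * v 8,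
    -((b + c) * v 11), (b + c) * v 10, -((a + b + c) * v 13), (a + b + c) * v 12]

lemma hasDerivAt_rotation_fst {θ : ℝ → ℝ} {θ' t : ℝ} (hθ : HasDerivAt θ θ' t) (p q : ℝ) :
    HasDerivAt (fun t => cos (θ t) * p - sin (θ t) * q)
      (cos (θ t) * -(θ' * q) - sin (θ t) * (θ' * p)) t := by
  exact ((hθ.cos.mul_const p).sub (hθ.sin.mul_const q)).congr_deriv (by ring)

lemma hasDerivAt_rotation_snd {θ : ℝ → ℝ} {θ' t : ℝ} (hθ : HasDerivAt θ θ' t) (p q : ℝ) :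
    HasDerivAt (fun t => sin (θ t) * p + cos (θ t) * q)
      (sin (θ t) * -(θ' * q) + cos (θ t) * (θ' * p)) t := by
  exact ((hθ.sin.mul_const p).add (hθ.cos.mul_const q)).congr_deriv (by ring)

lemma hasDerivAt_R₄_mulVec {α β γ : ℝ → ℝ} {a b c t : ℝ} (hα : HasDerivAt α a t)
    (hβ : HasDerivAt β b t) (hγ : HasDerivAt γ c t) (v : Fin 14 → ℝ) :
    HasDerivAt (fun t => R₄ (α t) (β t) (γ t) *ᵥ v)
      (R₄ (α t) (β t) (γ t) *ᵥ rotGen a b c v) t := by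
  simp only [R₄_mulVec]
  rw [hasDerivAt_pi]
  intro i
  fin_cases i
  · exact hasDerivAt_rotation_fst hα _ _
  · exact hasDerivAt_rotation_snd hα _ _
  · exact hasDerivAt_rotation_fst hβ _ _
  · exact hasDerivAt_rotation_snd hβ _ _
  · exact hasDerivAt_rotation_fst hγ _ _
  · exact hasDerivAt_rotation_snd hγ _ _
  · exact hasDerivAt_rotation_fst (hα.add hβ) _ _
  · exact hasDerivAt_rotation_snd (hα.add hβ) _ _
  · exact hasDerivAt_rotation_fst (hα.add hγ) _ _
  · exact hasDerivAt_rotation_snd (hα.add hγ) _ _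
  · exact hasDerivAt_rotation_fst (hβ.add hγ) _ _
  · exact hasDerivAt_rotation_snd (hβ.add hγ) _ _
  · exact hasDerivAt_rotation_fst ((hα.add hβ).add hγ) _ _
  · exact hasDerivAt_rotation_snd ((hα.add hβ).add hγ) _ _

lemma deriv_R₄_mulVec₁ (x₁ x₂ x₃ : ℝ) (v : Fin 14 → ℝ) :
    deriv (fun t => R₄ t x₂ x₃ *ᵥ v) x₁ = R₄ x₁ x₂ x₃ *ᵥ rotGen 1 0 0 v :=
  (hasDerivAt_R₄_mulVec (hasDerivAt_id' x₁) (hasDerivAt_const x₁ x₂)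
    (hasDerivAt_const x₁ x₃) v).deriv

lemma deriv_R₄_mulVec₂ (x₁ x₂ x₃ : ℝ) (v : Fin 14 → ℝ) :
    deriv (fun t => R₄ x₁ t x₃ *ᵥ v) x₂ = R₄ x₁ x₂ x₃ *ᵥ rotGen 0 1 0 v :=
  (hasDerivAt_R₄_mulVec (hasDerivAt_const x₂ x₁) (hasDerivAt_id' x₂)
    (hasDerivAt_const x₂ x₃) v).deriv

lemma deriv_R₄_mulVec₃ (x₁ x₂ x₃ : ℝ) (v : Fin 14 → ℝ) :
    deriv (fun t => R₄ x₁ x₂ t *ᵥ v) x₃ = R₄ x₁ x₂ x₃ *ᵥ rotGen 0 0 1 v :=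
  (hasDerivAt_R₄_mulVec (hasDerivAt_const x₃ x₁) (hasDerivAt_const x₃ x₂)
    (hasDerivAt_id' x₃) v).deriv

lemma deriv_mulVec {m n : Type*} [Fintype m] [Fintype n] (M : Matrix m n ℝ) {v : ℝ → n → ℝ}
    {v' : n → ℝ} {t : ℝ} (hv : HasDerivAt v v' t) :
    deriv (fun t => M *ᵥ v t) t = M *ᵥ v' :=
  ((M.mulVecLin.toContinuousLinearMap.hasFDerivAt).comp_hasDerivAt t hv).deriv

lemma hasDerivAt_rotGen (a b c : ℝ) {v : ℝ → Fin 14 → ℝ} {v' : Fin 14 → ℝ} {t : ℝ}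
    (hv : HasDerivAt v v' t) :
    HasDerivAt (fun t => rotGen a b c (v t)) (rotGen a b c v') t := by
  rw [hasDerivAt_pi] at hv ⊢
  intro i
  fin_cases i
  · exact ((hv 1).const_mul _).neg
  · exact (hv 0).const_mul _
  · exact ((hv 3).const_mul _).neg
  · exact (hv 2).const_mul _
  · exact ((hv 5).const_mul _).neg
  · exact (hv 4).const_mul _
  · exact ((hv 7).const_mul _).neg
  · exact (hv 6).const_mul _
  · exact ((hv 9).const_mul _).neg
  · exact (hv 8).const_mul _
  · exact ((hv 11).const_mul _).neg
  · exact (hv 10).const_mul _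
  · exact ((hv 13).const_mul _).neg
  · exact (hv 12).const_mul _

/-- The derivative of `v₄`. -/
noncomputable def v₄' (z : ℝ) : Fin 14 → ℝ :=
  ![0, cos z, -sin z, cos z, -sin z, cos z, -sin z, sin z,
    -2 * cos z + 5 * sin z, cos z, -sin z, cos z, -sin z,
    9 * cos z - 13 * sin z - 14 * cos (2 * z) - 6 * sin (2 * z)]

/-- The second derivative of `v₄`. -/
noncomputable def v₄'' (z : ℝ) : Fin 14 → ℝ :=
  ![0, -sin z, -cos z, -sin z, -cos z, -sin z, -cos z, cos z,
    2 * sin z + 5 * cos z, -sin z, -cos z, -sin z, -cos z,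
    -9 * sin z - 13 * cos z + 28 * sin (2 * z) - 12 * cos (2 * z)]

lemma hasDerivAt_sin_two_mul (z : ℝ) :
    HasDerivAt (fun z => sin (2 * z)) (2 * cos (2 * z)) z := by
  simpa [mul_comm] using ((hasDerivAt_id' z).const_mul 2).sin

lemma hasDerivAt_cos_two_mul (z : ℝ) :
    HasDerivAt (fun z => cos (2 * z)) (-(2 * sin (2 * z))) z := by
  simpa [mul_comm] using ((hasDerivAt_id' z).const_mul 2).cos

lemma hasDerivAt_h (z : ℝ) :
    HasDerivAt h (9 * cos z - 13 * sin z - 14 * cos (2 * z) - 6 * sin (2 * z)) z :=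
  ((((((hasDerivAt_sin z).const_mul 9).const_add (-20)).add
    ((hasDerivAt_cos z).const_mul 13)).sub ((hasDerivAt_sin_two_mul z).const_mul 7)).add
    ((hasDerivAt_cos_two_mul z).const_mul 3)).congr_deriv (by ring)

lemma hasDerivAt_v₄ (z : ℝ) : HasDerivAt v₄ (v₄' z) z := by
  have hs := hasDerivAt_sin z
  have hc := hasDerivAt_cos z
  rw [hasDerivAt_pi]
  intro i
  fin_cases i
  · exact hasDerivAt_const z 2
  · exact hs.const_add 1
  · exact hc
  · exact hs.const_add (1 / 2)
  · exact hc
  · exact hs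
  · exact hc
  · exact (hc.const_sub 2).congr_deriv (neg_neg _)
  · exact ((hs.const_mul (-2)).sub (hc.const_mul 5)).congr_deriv
      (show _ = -2 * cos z + 5 * sin z by ring)
  · exact hs
  · exact hc
  · exact hs
  · exact hc
  · exact hasDerivAt_h z

lemma hasDerivAt_v₄' (z : ℝ) : HasDerivAt v₄' (v₄'' z) z := by
  have hs := hasDerivAt_sin z
  have hc := hasDerivAt_cos z
  rw [hasDerivAt_pi]
  intro i
  fin_cases i
  · exact hasDerivAt_const z 0
  · exact hc
  · exact hs.neg
  · exact hc
  · exact hs.neg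
  · exact hc
  · exact hs.neg
  · exact hs
  · exact ((hc.const_mul (-2)).add (hs.const_mul 5)).congr_deriv
      (show _ = 2 * sin z + 5 * cos z by ring)
  · exact hc
  · exact hs.neg
  · exact hc
  · exact hs.neg
  · exact ((((hc.const_mul 9).sub (hs.const_mul 13)).sub
      ((hasDerivAt_cos_two_mul z).const_mul 14)).sub
      ((hasDerivAt_sin_two_mul z).const_mul 6)).congr_deriv
      (show _ = -9 * sin z - 13 * cos z + 28 * sin (2 * z) - 12 * cos (2 * z) by ring)

lemma eq_zero_of_rotation_eq_zero {θ p q : ℝ} (h₁ : cos θ * p - sin θ * q = 0)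
    (h₂ : sin θ * p + cos θ * q = 0) : p = 0 ∧ q = 0 := by
  have hθ := sin_sq_add_cos_sq θ
  constructor
  · linear_combination cos θ * h₁ + sin θ * h₂ - p * hθ
  · linear_combination -sin θ * h₁ + cos θ * h₂ - q * hθ

lemma ker_mulVecLin_R₄ (x₁ x₂ x₃ : ℝ) : LinearMap.ker (R₄ x₁ x₂ x₃).mulVecLin = ⊥ := by
  rw [LinearMap.ker_eq_bot']
  intro v hv
  rw [mulVecLin_apply, R₄_mulVec] at hv
  have h₁ := eq_zero_of_rotation_eq_zero (congrFun hv 0) (congrFun hv 1)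
  have h₂ := eq_zero_of_rotation_eq_zero (congrFun hv 2) (congrFun hv 3)
  have h₃ := eq_zero_of_rotation_eq_zero (congrFun hv 4) (congrFun hv 5)
  have h₄ := eq_zero_of_rotation_eq_zero (congrFun hv 6) (congrFun hv 7)
  have h₅ := eq_zero_of_rotation_eq_zero (congrFun hv 8) (congrFun hv 9)
  have h₆ := eq_zero_of_rotation_eq_zero (congrFun hv 10) (congrFun hv 11)
  have h₇ := eq_zero_of_rotation_eq_zero (congrFun hv 12) (congrFun hv 13)
  ext i
  fin_cases i
  exacts [h₁.1, h₁.2, h₂.1, h₂.2, h₃.1, h₃.2, h₄.1, h₄.2, h₅.1, h₅.2, h₆.1, h₆.2, h₇.1, h₇.2]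

lemma contDiff_F₄ :
    ContDiff ℝ (⊤ : ℕ∞) (fun p : ℝ × ℝ × ℝ × ℝ => F₄ p.1 p.2.1 p.2.2.1 p.2.2.2) := by
  simp only [F₄, R₄_mulVec]
  rw [contDiff_pi]
  intro i
  fin_cases i <;> simp [v₄, h] <;> fun_prop

lemma h_add_two_pi (z : ℝ) : h (z + 2 * π) = h z := by
  have : 2 * (z + 2 * π) = 2 * z + 2 * π + 2 * π := by ring
  simp [h, this]

lemma v₄_add_two_pi (z : ℝ) : v₄ (z + 2 * π) = v₄ z := by
  simp [v₄, h_add_two_pi]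

lemma F₄_periodic (x₁ x₂ x₃ z : ℝ) :
    F₄ (x₁ + 2 * π) x₂ x₃ z = F₄ x₁ x₂ x₃ z ∧
    F₄ x₁ (x₂ + 2 * π) x₃ z = F₄ x₁ x₂ x₃ z ∧
    F₄ x₁ x₂ (x₃ + 2 * π) z = F₄ x₁ x₂ x₃ z ∧
    F₄ x₁ x₂ x₃ (z + 2 * π) = F₄ x₁ x₂ x₃ z := by
  refine ⟨?_, ?_, ?_, ?_⟩
  · simp [F₄, R₄, add_right_comm _ (2 * π)]
  · simp [F₄, R₄, ← add_assoc, add_right_comm _ (2 * π)]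
  · simp [F₄, R₄, ← add_assoc]
  · simp [F₄, v₄_add_two_pi]

/-- A form of degree eleven whose value at `r = 1` is, on the circle `c ^ 2 + s ^ 2 = 1`, a positive
multiple of the determinant of `reducedMatrix c s`. -/
def detForm (r c s : ℝ) : ℝ :=
  60170 * r ^ 11 + 284470 * r ^ 10 * s + 612480 * r ^ 9 * s ^ 2 - 733010 * r ^ 8 * s ^ 3
  - 2858300 * r ^ 7 * s ^ 4 + 520800 * r ^ 6 * s ^ 5 + 4150190 * r ^ 5 * s ^ 6
  + 197500 * r ^ 4 * s ^ 7 - 2115900 * r ^ 3 * s ^ 8 - 311920 * r ^ 2 * s ^ 9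
  + 173120 * r * s ^ 10 + 26240 * s ^ 11 - 59850 * r ^ 10 * c - 276930 * r ^ 9 * c * s
  - 607330 * r ^ 8 * c * s ^ 2 + 447710 * r ^ 7 * c * s ^ 3 + 2291340 * r ^ 6 * c * s ^ 4
  + 393060 * r ^ 5 * c * s ^ 5 - 2093060 * r ^ 4 * c * s ^ 6 - 624860 * r ^ 3 * c * s ^ 7
  + 437280 * r ^ 2 * c * s ^ 8 + 100800 * r * c * s ^ 9 - 640 * c * s ^ 10

lemma detForm_pos {x y : ℝ} (hxy : x ^ 2 + y ^ 2 = 1) :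
    0 < detForm (x ^ 2 + y ^ 2) (x ^ 2 - y ^ 2) (2 * x * y) := by
  have key : detForm (x ^ 2 + y ^ 2) (x ^ 2 - y ^ 2) (2 * x * y) =
      (-2801 / 200 * x ^ 11 - 246513 / 1000 * y * x ^ 10 + 1400569 / 500 * y ^ 2 * x ^ 9
        + 3822767 / 500 * y ^ 3 * x ^ 8 - 4928801 / 200 * y ^ 4 * x ^ 7
        - 41740609 / 1000 * y ^ 5 * x ^ 6 + 5354498 / 125 * y ^ 6 * x ^ 5
        + 1661431 / 40 * y ^ 7 * x ^ 4 - 487759 / 25 * y ^ 8 * x ^ 3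
        - 10002259 / 1000 * y ^ 9 * x ^ 2 + 1620501 / 1000 * y ^ 10 * x
        + 86609 / 250 * y ^ 11) ^ 2 +
      (-11039 / 1000 * x ^ 11 - 370279 / 1000 * y * x ^ 10 - 1104271 / 1000 * y ^ 2 * x ^ 9
        + 5581741 / 500 * y ^ 3 * x ^ 8 + 192847 / 8 * y ^ 4 * x ^ 7
        - 3733001 / 100 * y ^ 5 * x ^ 6 - 12262891 / 250 * y ^ 6 * x ^ 5
        + 35472903 / 1000 * y ^ 7 * x ^ 4 + 2417913 / 100 * y ^ 8 * x ^ 3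
        - 904018 / 125 * y ^ 9 * x ^ 2 - 1611211 / 500 * y ^ 10 * x) ^ 2 +
      (19249 / 10000 * x ^ 22 + 22459331 / 1000000 * y ^ 2 * x ^ 20
        + 71203153 / 1000000 * y ^ 4 * x ^ 18 + 396754309 / 1000000 * y ^ 6 * x ^ 16
        + 109758787 / 200000 * y ^ 8 * x ^ 14 + 35924243 / 40000 * y ^ 10 * x ^ 12
        + 393828641 / 500000 * y ^ 12 * x ^ 10 + 48079133 / 62500 * y ^ 14 * x ^ 8
        + 90870003 / 500000 * y ^ 16 * x ^ 6 + 134601119 / 1000000 * y ^ 18 * x ^ 4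
        + 252957 / 15625 * y ^ 20 * x ^ 2 + 99117 / 50000 * y ^ 22 + 37777 / 500000 * x ^ 20
        * (x + y) ^ 2 + 2048347 / 1000000 * y ^ 2 * x ^ 18 * (x - y) ^ 2
        + 417811 / 200000 * y ^ 4 * x ^ 16 * (x + y) ^ 2 + 411511 / 50000 * y ^ 6 * x ^ 14
        * (x - y) ^ 2 + 27384539 / 1000000 * y ^ 8 * x ^ 12 * (x + y) ^ 2
        + 43898881 / 1000000 * y ^ 10 * x ^ 10 * (x - y) ^ 2
        + 32820159 / 1000000 * y ^ 12 * x ^ 8 * (x + y) ^ 2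
        + 5886319 / 1000000 * y ^ 14 * x ^ 6 * (x + y) ^ 2
        + 12793753 / 1000000 * y ^ 16 * x ^ 4 * (x - y) ^ 2
        + 1855951 / 1000000 * y ^ 18 * x ^ 2 * (x + y) ^ 2 + 28891 / 250000 * y ^ 20 * (x
        + y) ^ 2) := by
    unfold detForm
    ring
  rw [key]
  rcases eq_or_ne x 0 with rfl | hx
  · have hy : y ≠ 0 := by
      rintro rfl
      norm_num at hxy
    positivity
  · positivity

lemma detForm_cos_sin_pos (z : ℝ) : 0 < detForm 1 (cos z) (sin z) := by
  have hz : z = 2 * (z / 2) := by ring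
  have h1 := cos_sq_add_sin_sq (z / 2)
  have hpos := detForm_pos h1
  rwa [h1, ← cos_two_mul', mul_right_comm, ← sin_two_mul, ← hz] at hpos

/-- The matrix of the linear system that remains after eliminating nine of the fourteen
coefficients of a vanishing linear combination of the derivatives of `F₄`. -/
def reducedMatrix (c s : ℝ) : Matrix (Fin 5) (Fin 5) ℝ :=
  !![5 + 2 * s + s ^ 2,
      -2 * c ^ 2,
      -2 * s,
      c + c * s,
      0;
    -2 + 2 * c - c ^ 2,
      -2 * s - s ^ 2 + 3 * c * s + c * s ^ 2,
      s - c - c * s,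
      -s + c * s,
      0;
    s ^ 2 + 4 * c * s + 5 * c ^ 2,
      2 * c * s ^ 2 + 4 * c ^ 2 * s + 6 * c ^ 3,
      0,
      0,
      -2 * s ^ 2 - 4 * c * s + 2 * c ^ 2;
    40 - 18 * s + 6 * s ^ 2 - 25 * c + 27 * c * s + 4 * c * s ^ 2 - 8 * c ^ 2 + 8 * c ^ 2 * s
      - 4 * c ^ 3,
      52 * s - 30 * s ^ 2 - 28 * s ^ 3 + 4 * c + 20 * c * s + 32 * c * s ^ 2 + 30 * c ^ 2
      + 56 * c ^ 2 * s + 4 * c ^ 2 * s ^ 2 - 6 * c ^ 3 + 8 * c ^ 3 * s - 4 * c ^ 4,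
      -26 * s + 28 * s ^ 2 + 14 * c - 26 * c * s + 2 * c * s ^ 2 - 28 * c ^ 2 + 2 * c ^ 3,
      2 * c * s - c ^ 2,
      26 * s - 28 * s ^ 2 - 18 * c + 24 * c * s - 10 * c * s ^ 2 + 28 * c ^ 2 + 8 * c ^ 2 * s
      - 2 * c ^ 3;
    -20 + 29 * s - 92 * s ^ 2 + 39 * s ^ 3 - 12 * s ^ 4 + 55 * c - 205 * c * s + 144 * c * s ^ 2
      - 80 * c * s ^ 3 + 57 * c ^ 2 + 93 * c ^ 2 * s - 88 * c ^ 2 * s ^ 2 - 58 * c ^ 3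
      + 80 * c ^ 3 * s - 12 * c ^ 4,
      -124 * s + 12 * s ^ 2 - 6 * s ^ 4 + 104 * c * s - 166 * c * s ^ 2 + 8 * c * s ^ 3
      - 12 * c * s ^ 4 - 16 * c ^ 2 - 118 * c ^ 2 * s + 130 * c ^ 2 * s ^ 2 - 80 * c ^ 2 * s ^ 3
      + 108 * c ^ 3 + 68 * c ^ 3 * s - 88 * c ^ 3 * s ^ 2 - 52 * c ^ 4 + 80 * c ^ 4 * s
      - 12 * c ^ 5,
      40 + 6 * s - 28 * s ^ 2 + 24 * s ^ 3 - 6 * s ^ 4 - 52 * c + 114 * c * s + 54 * c * s ^ 2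
      - 28 * c * s ^ 3 - 70 * c ^ 2 + 12 * c ^ 2 * s + 26 * c ^ 3 - 28 * c ^ 3 * s + 6 * c ^ 4,
      -40 * s + 18 * s ^ 2 - 6 * s ^ 3 + 20 * c + 17 * c * s - 25 * c * s ^ 2 - 13 * c ^ 2
      + 20 * c ^ 2 * s - 3 * c ^ 3,
      -2 * s + 200 * s ^ 2 - 90 * s ^ 3 + 30 * s ^ 4 - 160 * c * s - 58 * c * s ^ 2
      + 116 * c * s ^ 3 + 40 * c ^ 2 + 86 * c ^ 2 * s - 136 * c ^ 2 * s ^ 2 - 26 * c ^ 3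
      + 52 * c ^ 3 * s - 6 * c ^ 4]

lemma det_reducedMatrix {c s : ℝ} (hcs : c ^ 2 + s ^ 2 = 1) :
    (reducedMatrix c s).det = 2 / 5 * detForm 1 c s := by
  simp [reducedMatrix, det_succ_row_zero, Fin.sum_univ_succ, Fin.succAbove, detForm]
  linear_combination (
    24068 + 113788 * s + 269060 * s ^ 2 - 179416 * s ^ 3 - 895060 * s ^ 4 + 42184 * s ^ 5
    + 779328 * s ^ 6 + 111184 * s ^ 7 - 69024 * s ^ 8 - 10808 * s ^ 9 + 336 * s ^ 10 - 23940 * c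
    - 110772 * c * s - 266872 * c * s ^ 2 + 27032 * c * s ^ 3 + 674016 * c * s ^ 4
    + 133488 * c * s ^ 5 - 192540 * c * s ^ 6 - 49480 * c * s ^ 7 + 3348 * c * s ^ 8
    + 1616 * c * s ^ 9 - 336 * c * s ^ 10 + 24068 * c ^ 2 + 113788 * c ^ 2 * s
    + 315208 * c ^ 2 * s ^ 2 - 82620 * c ^ 2 * s ^ 3 - 713964 * c ^ 2 * s ^ 4
    - 54008 * c ^ 2 * s ^ 5 + 62816 * c ^ 2 * s ^ 6 + 21788 * c ^ 2 * s ^ 7 - 4896 * c ^ 2 * s ^ 8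
    - 1304 * c ^ 2 * s ^ 9 - 23940 * c ^ 3 - 109812 * c ^ 3 * s - 328668 * c ^ 3 * s ^ 2
    + 137876 * c ^ 3 * s ^ 3 + 248948 * c ^ 3 * s ^ 4 + 85880 * c ^ 3 * s ^ 5
    + 2340 * c ^ 3 * s ^ 6 - 1260 * c ^ 3 * s ^ 7 + 1148 * c ^ 3 * s ^ 8 + 23428 * c ^ 4
    + 165820 * c ^ 4 * s + 340100 * c ^ 4 * s ^ 2 - 173952 * c ^ 4 * s ^ 3 - 46924 * c ^ 4 * s ^ 4
    - 32068 * c ^ 4 * s ^ 5 + 5372 * c ^ 4 * s ^ 6 - 1024 * c ^ 4 * s ^ 7 - 36868 * c ^ 5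
    - 226836 * c ^ 5 * s - 155804 * c ^ 5 * s ^ 2 - 21968 * c ^ 5 * s ^ 3 - 62864 * c ^ 5 * s ^ 4
    - 88 * c ^ 5 * s ^ 5 + 7412 * c ^ 5 * s ^ 6 + 49252 * c ^ 6 + 160112 * c ^ 6 * s
    + 25524 * c ^ 6 * s ^ 2 - 33164 * c ^ 6 * s ^ 3 + 21744 * c ^ 6 * s ^ 4 + 6976 * c ^ 6 * s ^ 5
    - 35140 * c ^ 7 - 21752 * c ^ 7 * s - 17548 * c ^ 7 * s ^ 2 - 3836 * c ^ 7 * s ^ 3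
    + 7924 * c ^ 7 * s ^ 4 + 15976 * c ^ 8 - 5588 * c ^ 8 * s - 5220 * c ^ 8 * s ^ 2
    + 5952 * c ^ 8 * s ^ 3 - 1836 * c ^ 9 - 992 * c ^ 9 * s + 1996 * c ^ 9 * s ^ 2 - 744 * c ^ 10
    - 744 * c ^ 10 * s) * hcs

/-- The linear system expressing that a linear combination of the derivatives of `F₄` vanishes,
written in the frame rotated by `R₄`. Here `a₁, a₂, a₃, b` are the coefficients of the first
derivatives, `d₁, d₂, d₃, e` those of the second derivatives involving `z`, and `q₁, …, q₆` are the
values of the quadratic form of the remaining coefficients at the first six phases. -/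
lemma eq_zero_of_rotated_system {c s : ℝ} (hcs : c ^ 2 + s ^ 2 = 1)
    (hdet : (reducedMatrix c s).det ≠ 0) {a₁ a₂ a₃ b q₁ q₂ q₃ q₄ q₅ q₆ d₁ d₂ d₃ e : ℝ}
    (h₁ : -(q₁ * 2) - a₁ * (1 + s) - d₁ * c = 0)
    (h₁' : -(q₁ * (1 + s)) + a₁ * 2 + b * c - e * s = 0)
    (h₂ : -(q₂ * c) - a₂ * (1 / 2 + s) - b * s - d₂ * c - e * c = 0)
    (h₂' : -(q₂ * (1 / 2 + s)) + a₂ * c + b * c - d₂ * s - e * s = 0)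
    (h₃ : -(q₃ * c) - a₃ * s - b * s - d₃ * c - e * c = 0)
    (h₃' : -(q₃ * s) + a₃ * c + b * c - d₃ * s - e * s = 0)
    (h₄ : -(q₄ * c) - (a₁ + a₂) * (2 - c) - b * s - (d₁ + d₂) * s - e * c = 0)
    (h₄' : -(q₄ * (2 - c)) + (a₁ + a₂) * c + b * s - (d₁ + d₂) * s + e * c = 0)
    (h₅ : q₅ * (2 * s + 5 * c) - (a₁ + a₃) * s + b * (5 * s - 2 * c) - (d₁ + d₃) * c +
      e * (2 * s + 5 * c) = 0)
    (h₅' : -(q₅ * s) - (a₁ + a₃) * (2 * s + 5 * c) + b * c + (d₁ + d₃) * (5 * s - 2 * c) -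
      e * s = 0)
    (h₆ : -(q₆ * c) - (a₂ + a₃) * s - b * s - (d₂ + d₃) * c - e * c = 0)
    (h₆' : -(q₆ * s) + (a₂ + a₃) * c + b * c - (d₂ + d₃) * s - e * s = 0)
    (h₇ : -((q₄ + q₅ + q₆ - q₁ - q₂ - q₃) * c) -
      (a₁ + a₂ + a₃) * (-20 + 9 * s + 13 * c - 14 * s * c + 3 * (c ^ 2 - s ^ 2)) - b * s -
      (d₁ + d₂ + d₃) * (9 * c - 13 * s - 14 * (c ^ 2 - s ^ 2) - 12 * s * c) - e * c = 0)
    (h₇' : -((q₄ + q₅ + q₆ - q₁ - q₂ - q₃) *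
        (-20 + 9 * s + 13 * c - 14 * s * c + 3 * (c ^ 2 - s ^ 2))) + (a₁ + a₂ + a₃) * c +
      b * (9 * c - 13 * s - 14 * (c ^ 2 - s ^ 2) - 12 * s * c) - (d₁ + d₂ + d₃) * s +
      e * (-9 * s - 13 * c + 56 * s * c - 12 * (c ^ 2 - s ^ 2)) = 0) :
    (a₁ = 0 ∧ a₂ = 0 ∧ a₃ = 0 ∧ b = 0) ∧
    (q₁ = 0 ∧ q₂ = 0 ∧ q₃ = 0 ∧ q₄ = 0 ∧ q₅ = 0 ∧ q₆ = 0) ∧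
    (d₁ = 0 ∧ d₂ = 0 ∧ d₃ = 0 ∧ e = 0) := by
  have ha₃ : a₃ = -b := by linear_combination c * h₃' - s * h₃ - (a₃ + b) * hcs
  have hq₃ : q₃ = -d₃ - e := by linear_combination -c * h₃ - s * h₃' - (q₃ + d₃ + e) * hcs
  have ha₂ : a₂ = 0 := by
    linear_combination c * h₆' - s * h₆ - (a₂ + a₃ + b) * hcs - ha₃
  have hq₆ : q₆ = -(d₂ + d₃) - e := by
    linear_combination -c * h₆ - s * h₆' - (q₆ + d₂ + d₃ + e) * hcs
  subst ha₃ hq₃ ha₂ hq₆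
  obtain ⟨l, rfl⟩ : ∃ l, q₂ = -2 * l := ⟨-q₂ / 2, by ring⟩
  have hb : b = -(l * c) := by linear_combination c * h₂' - s * h₂ - b * hcs
  have hd₂ : d₂ = l * (2 + s) - e := by
    linear_combination -c * h₂ - s * h₂' - (d₂ + e - 2 * l) * hcs
  subst hb hd₂
  obtain ⟨w, rfl⟩ : ∃ w, d₃ = w - d₁ := ⟨d₁ + d₃, by ring⟩
  have hq₁ : q₁ = -(a₁ * (1 + s) + d₁ * c) / 2 := by linear_combination -h₁ / 2
  have hq₄ : q₄ = -a₁ * (1 - c) - (d₁ + l * (2 + s) - e) * s := by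
    linear_combination -(h₄ + h₄') / 2
  have hq₅ : q₅ = s * (-(a₁ + l * c) * (2 * s + 5 * c) - l * c * c + w * (5 * s - 2 * c) - e * s) +
      c / 5 * ((a₁ + l * c) * s + l * c * (5 * s - 2 * c) + w * c - e * (2 * s + 5 * c) -
        2 * (-(a₁ + l * c) * (2 * s + 5 * c) - l * c * c + w * (5 * s - 2 * c) - e * s)) := by
    linear_combination -q₅ * hcs - s * h₅' + c / 5 * h₅ + 2 * c / 5 * h₅'
  have hM : reducedMatrix c s *ᵥ ![a₁, l, e, d₁, w] = 0 := by
    subst hq₁ hq₄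
    have hsys : ∀ i, (reducedMatrix c s *ᵥ ![a₁, l, e, d₁, w]) i = 0 := by
      simp only [Fin.forall_fin_succ]
      simp [reducedMatrix, mulVec, dotProduct, Fin.sum_univ_succ]
      refine ⟨?_, ?_, ?_, ?_, ?_⟩
      · linear_combination 2 * h₁'
      · linear_combination h₄ - c * (h₄ + h₄') / 2
      · linear_combination -s / 5 * h₅ - (2 * s + 5 * c) / 5 * h₅'
      · subst hq₅
        linear_combination 2 * h₇
      · subst hq₅
        linear_combination 2 * h₇'
    exact funext hsys
  have hx := eq_zero_of_mulVec_eq_zero hdet hM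
  obtain rfl : a₁ = 0 := congrFun hx 0
  obtain rfl : l = 0 := congrFun hx 1
  obtain rfl : e = 0 := congrFun hx 2
  obtain rfl : d₁ = 0 := congrFun hx 3
  obtain rfl : w = 0 := congrFun hx 4
  simp [hq₁, hq₄, hq₅]

lemma linearIndependent_derivatives_v₄ (z : ℝ) : LinearIndependent ℝ
    ![rotGen 1 0 0 (v₄ z), rotGen 0 1 0 (v₄ z), rotGen 0 0 1 (v₄ z), v₄' z,
      rotGen 1 0 0 (rotGen 1 0 0 (v₄ z)), rotGen 0 1 0 (rotGen 1 0 0 (v₄ z)),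
      rotGen 0 0 1 (rotGen 1 0 0 (v₄ z)), rotGen 0 1 0 (rotGen 0 1 0 (v₄ z)),
      rotGen 0 0 1 (rotGen 0 1 0 (v₄ z)), rotGen 0 0 1 (rotGen 0 0 1 (v₄ z)),
      rotGen 1 0 0 (v₄' z), rotGen 0 1 0 (v₄' z), rotGen 0 0 1 (v₄' z), v₄'' z] := by
  rw [Fintype.linearIndependent_iff]
  intro g hg
  have hcoord (j : Fin 14) := congrFun hg j
  simp [Fin.sum_univ_succ, Fin.forall_fin_succ, rotGen, v₄, v₄', v₄'', h, sin_two_mul,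
    cos_two_mul'] at hcoord
  obtain ⟨hr₁, hi₁, hr₂, hi₂, hr₃, hi₃, hr₄, hi₄, hr₅, hi₅, hr₆, hi₆, hr₇, hi₇⟩ := hcoord
  have hdet : (reducedMatrix (cos z) (sin z)).det ≠ 0 := by
    rw [det_reducedMatrix (cos_sq_add_sin_sq z)]
    have := detForm_cos_sin_pos z
    positivity
  obtain ⟨⟨ha₁, ha₂, ha₃, hb⟩, ⟨hq₁, hq₂, hq₃, hq₄, hq₅, hq₆⟩, hd₁, hd₂, hd₃, he⟩ :=
    eq_zero_of_rotated_system (cos_sq_add_sin_sq z) hdet (a₁ := g 0) (a₂ := g 1) (a₃ := g 2)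
      (b := g 3) (q₁ := g 4) (q₂ := g 7) (q₃ := g 9) (q₄ := g 4 + g 5 + g 7)
      (q₅ := g 4 + g 6 + g 9) (q₆ := g 7 + g 8 + g 9) (d₁ := g 10) (d₂ := g 11) (d₃ := g 12)
      (e := g 13) (by linear_combination hr₁) (by linear_combination hi₁)
      (by linear_combination hr₂) (by linear_combination hi₂) (by linear_combination hr₃)
      (by linear_combination hi₃) (by linear_combination hr₄) (by linear_combination hi₄)
      (by linear_combination hr₅) (by linear_combination hi₅) (by linear_combination hr₆)
      (by linear_combination hi₆) (by linear_combination hr₇) (by linear_combination hi₇)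
  have h₅ : g 5 = 0 := by linarith
  have h₆ : g 6 = 0 := by linarith
  have h₈ : g 8 = 0 := by linarith
  intro i
  fin_cases i <;> assumption

lemma linearIndependent_derivatives_F₄ (x₁ x₂ x₃ z : ℝ) : LinearIndependent ℝ
      ![deriv (fun t => F₄ t x₂ x₃ z) x₁,
      deriv (fun t => F₄ x₁ t x₃ z) x₂,
      deriv (fun t => F₄ x₁ x₂ t z) x₃,
      deriv (fun t => F₄ x₁ x₂ x₃ t) z,
      deriv (fun t => deriv (fun s => F₄ s x₂ x₃ z) t) x₁,
      deriv (fun t => deriv (fun s => F₄ s t x₃ z) x₁) x₂,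
      deriv (fun t => deriv (fun s => F₄ s x₂ t z) x₁) x₃,
      deriv (fun t => deriv (fun s => F₄ x₁ s x₃ z) t) x₂,
      deriv (fun t => deriv (fun s => F₄ x₁ s t z) x₂) x₃,
      deriv (fun t => deriv (fun s => F₄ x₁ x₂ s z) t) x₃,
      deriv (fun t => deriv (fun s => F₄ s x₂ x₃ t) x₁) z,
      deriv (fun t => deriv (fun s => F₄ x₁ s x₃ t) x₂) z,
      deriv (fun t => deriv (fun s => F₄ x₁ x₂ s t) x₃) z,
      deriv (fun t => deriv (fun s => F₄ x₁ x₂ x₃ s) t) z] := by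
  simp only [F₄, deriv_R₄_mulVec₁, deriv_R₄_mulVec₂, deriv_R₄_mulVec₃,
    fun M t => deriv_mulVec M (hasDerivAt_v₄ t), fun M t => deriv_mulVec M (hasDerivAt_v₄' t),
    fun M a b c t => deriv_mulVec M (hasDerivAt_rotGen a b c (hasDerivAt_v₄ t))]
  convert (linearIndependent_derivatives_v₄ z).map' _ (ker_mulVecLin_R₄ x₁ x₂ x₃) using 1
  · ext i : 1
    fin_cases i <;> rfl
  all_goals rfl

/-- `F₄` is free: at every point the fourteen vectors of first and second
partial derivatives are linearly independent in `ℝ¹⁴` (the critical dimension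
`q₄ = 4·(4+3)/2 = 14`). Moreover `F₄` is smooth and `2π`-periodic in each variable,
hence induces a smooth free map of the 4-torus `T⁴` into `ℝ¹⁴`. -/
theorem F₄_free :
    (∀ x₁ x₂ x₃ z : ℝ, LinearIndependent ℝ
      ![deriv (fun t => F₄ t x₂ x₃ z) x₁,
      deriv (fun t => F₄ x₁ t x₃ z) x₂,
      deriv (fun t => F₄ x₁ x₂ t z) x₃,
      deriv (fun t => F₄ x₁ x₂ x₃ t) z,
      deriv (fun t => deriv (fun s => F₄ s x₂ x₃ z) t) x₁,
      deriv (fun t => deriv (fun s => F₄ s t x₃ z) x₁) x₂,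
      deriv (fun t => deriv (fun s => F₄ s x₂ t z) x₁) x₃,
      deriv (fun t => deriv (fun s => F₄ x₁ s x₃ z) t) x₂,
      deriv (fun t => deriv (fun s => F₄ x₁ s t z) x₂) x₃,
      deriv (fun t => deriv (fun s => F₄ x₁ x₂ s z) t) x₃,
      deriv (fun t => deriv (fun s => F₄ s x₂ x₃ t) x₁) z,
      deriv (fun t => deriv (fun s => F₄ x₁ s x₃ t) x₂) z,
      deriv (fun t => deriv (fun s => F₄ x₁ x₂ s t) x₃) z,
      deriv (fun t => deriv (fun s => F₄ x₁ x₂ x₃ s) t) z])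
    ∧ ContDiff ℝ (⊤ : ℕ∞) (fun p : ℝ × ℝ × ℝ × ℝ => F₄ p.1 p.2.1 p.2.2.1 p.2.2.2)
    ∧ (∀ x₁ x₂ x₃ z : ℝ,
        F₄ (x₁ + 2 * π) x₂ x₃ z = F₄ x₁ x₂ x₃ z ∧
        F₄ x₁ (x₂ + 2 * π) x₃ z = F₄ x₁ x₂ x₃ z ∧
        F₄ x₁ x₂ (x₃ + 2 * π) z = F₄ x₁ x₂ x₃ z ∧
        F₄ x₁ x₂ x₃ (z + 2 * π) = F₄ x₁ x₂ x₃ z) := by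
  exact ⟨linearIndependent_derivatives_F₄, contDiff_F₄, F₄_periodic⟩
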